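/- Let $m, l, n$ be positive integers, let $\tau$ denote normalized traces, and for $1 \le k \le n$ let $\pi_k : M_l \to M_{l^n} = M_l^{\otimes n}$ be the embedding $\pi_k(x) = 1 \otimes \cdots \otimes x \otimes \cdots \otimes 1$ ($x$ in position $k$). Let $a^1, \dots, a^n \in M_{ml}$ be positive matrices and $1 \le p < \infty$. Then there is an absolute constant $c$ (independent of all dimensions) such that $\Big\| \sum_{k=1}^n (\mathrm{id}_{M_m} \otimes \pi_k)(a^k) \Big\|_{L_p(\tau_{m l^n})} \le c\, p \, \max\Big\{ \Big\| \frac{1}{l} \sum_{k=1}^n \sum_{i=1}^l a^k_{ii} \Big\|_{L_p(\tau_m)}, \; \Big( \sum_{k=1}^n \|a^k\|_{L_p(\tau_{ml})}^p \Big)^{1/p} \Big\}$, where $a^k_{ii} \in M_m$ are the $M_m$-valued diagonal entries of $a^k \in M_m \otimes M_l$. -/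

import Mathlib

open scoped ENNReal BigOperators ComplexOrder
open Matrix

noncomputable def ctmEig {m n : Type*} [Fintype m] [Fintype n] [DecidableEq n]
    (a : Matrix m n ℂ) : n → ℝ :=
  (Matrix.posSemidef_conjTranspose_mul_self a).isHermitian.eigenvalues

/-- Schatten `p`-norm of a (rectangular) complex matrix; `p = ∞` is the operator norm. -/
noncomputable def schNorm {m n : Type*} [Fintype m] [Fintype n] [DecidableEq n]
    (p : ℝ≥0∞) (a : Matrix m n ℂ) : ℝ :=
  if p = ∞ then ⨆ j, Real.sqrt (ctmEig a j)
  else (∑ j, ctmEig a j ^ (p.toReal / 2)) ^ (1 / p.toReal)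

/-- Normalized (tracial) Schatten `p`-norm: `(τ |a|^p)^{1/p}` with `τ` the normalized trace. -/
noncomputable def ntrNorm {n : Type*} [Fintype n] [DecidableEq n]
    (p : ℝ) (a : Matrix n n ℂ) : ℝ :=
  ((∑ j, ctmEig a j ^ (p / 2)) / (Fintype.card n)) ^ (1 / p)

open scoped Classical in
/-- `(id_{M_m} ⊗ π_k)(a)` where `π_k : M_l → M_l^{⊗ n}` puts `x` in the `k`-th tensor leg. -/
noncomputable def ampl (m l n : ℕ) (k : Fin n)
    (a : Matrix (Fin m × Fin l) (Fin m × Fin l) ℂ) :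
    Matrix (Fin m × (Fin n → Fin l)) (Fin m × (Fin n → Fin l)) ℂ :=
  Matrix.of fun P Q =>
    if ∀ j, j ≠ k → P.2 j = Q.2 j then a (P.1, P.2 k) (Q.1, Q.2 k) else 0

open scoped Kronecker

section SpectralTrace

variable {ι : Type*} [Fintype ι]

/-- The real part of the trace of a complex matrix. -/
noncomputable def reTrace (A : Matrix ι ι ℂ) : ℝ := A.trace.re

lemma reTrace_sub (A B : Matrix ι ι ℂ) : reTrace (A - B) = reTrace A - reTrace B := by
  simp [reTrace]

lemma reTrace_sum {κ : Type*} (s : Finset κ) (A : κ → Matrix ι ι ℂ) :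
    reTrace (∑ k ∈ s, A k) = ∑ k ∈ s, reTrace (A k) := by
  simp [reTrace, Matrix.trace_sum]

lemma reTrace_mul_comm (A B : Matrix ι ι ℂ) : reTrace (A * B) = reTrace (B * A) := by
  rw [reTrace, Matrix.trace_mul_comm, reTrace]

variable [DecidableEq ι]

/-- The matrix of `X` with respect to the eigenbases of the Hermitian matrices `A` (rows) and
`B` (columns). -/
noncomputable def eigenCoeff {A B : Matrix ι ι ℂ} (hA : A.IsHermitian) (hB : B.IsHermitian)
    (X : Matrix ι ι ℂ) : Matrix ι ι ℂ :=
  (hA.eigenvectorUnitary : Matrix ι ι ℂ)ᴴ * X * (hB.eigenvectorUnitary : Matrix ι ι ℂ)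

lemma Matrix.continuousOn_spectrum_real (f : ℝ → ℝ) (A : Matrix ι ι ℂ) :
    ContinuousOn f (spectrum ℝ A) :=
  A.finite_real_spectrum.continuousOn f

lemma Matrix.IsHermitian.cfc_eq_mul_diagonal_mul {A : Matrix ι ι ℂ} (hA : A.IsHermitian)
    (f : ℝ → ℝ) :
    cfc f A = (hA.eigenvectorUnitary : Matrix ι ι ℂ) *
      diagonal (fun i => (f (hA.eigenvalues i) : ℂ)) *
        (hA.eigenvectorUnitary : Matrix ι ι ℂ)ᴴ := by
  rw [hA.cfc_eq]
  rfl

lemma Matrix.IsHermitian.eigenvectorUnitary_conjTranspose_mul {A : Matrix ι ι ℂ}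
    (hA : A.IsHermitian) :
    (hA.eigenvectorUnitary : Matrix ι ι ℂ)ᴴ * (hA.eigenvectorUnitary : Matrix ι ι ℂ) = 1 :=
  Unitary.coe_star_mul_self hA.eigenvectorUnitary

lemma Matrix.IsHermitian.eq_mul_diagonal_mul {A : Matrix ι ι ℂ} (hA : A.IsHermitian) :
    A = (hA.eigenvectorUnitary : Matrix ι ι ℂ) *
      diagonal (fun i => (hA.eigenvalues i : ℂ)) *
        (hA.eigenvectorUnitary : Matrix ι ι ℂ)ᴴ :=
  hA.spectral_theorem

lemma cfc_isHermitian (f : ℝ → ℝ) (A : Matrix ι ι ℂ) : (cfc f A).IsHermitian :=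
  cfc_predicate f A

lemma reTrace_conj_cfc_mul_cfc {A B : Matrix ι ι ℂ} (hA : A.IsHermitian) (hB : B.IsHermitian)
    (X : Matrix ι ι ℂ) (f g : ℝ → ℝ) :
    reTrace (Xᴴ * cfc f A * X * cfc g B) =
      ∑ i, ∑ j, f (hA.eigenvalues i) * g (hB.eigenvalues j) * ‖eigenCoeff hA hB X i j‖ ^ 2 := by
  have h : (Xᴴ * cfc f A * X * cfc g B).trace =
      ((eigenCoeff hA hB X)ᴴ * diagonal (fun i => (f (hA.eigenvalues i) : ℂ)) *
        eigenCoeff hA hB X * diagonal (fun i => (g (hB.eigenvalues i) : ℂ))).trace := by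
    rw [hA.cfc_eq_mul_diagonal_mul, hB.cfc_eq_mul_diagonal_mul, ← mul_assoc,
      Matrix.trace_mul_comm]
    simp only [eigenCoeff, conjTranspose_mul, conjTranspose_conjTranspose, mul_assoc]
  rw [reTrace, h, Finset.sum_comm]
  simp only [Matrix.trace, diag_apply, Matrix.mul_apply, conjTranspose_apply,
    diagonal_apply, mul_ite, mul_zero, Finset.sum_ite_eq', Finset.mem_univ, if_true,
    Complex.re_sum, Finset.sum_mul]
  refine Finset.sum_congr rfl fun j _ => Finset.sum_congr rfl fun i _ => ?_
  have h2 : star (eigenCoeff hA hB X i j) * (f (hA.eigenvalues i) : ℂ) * eigenCoeff hA hB X i j *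
      (g (hB.eigenvalues j) : ℂ) =
      ((f (hA.eigenvalues i) * g (hB.eigenvalues j) * ‖eigenCoeff hA hB X i j‖ ^ 2 : ℝ) : ℂ) := by
    have := Complex.conj_mul' (eigenCoeff hA hB X i j)
    push_cast
    rw [← this]
    simp only [RCLike.star_def]
    ring
  rw [h2, Complex.ofReal_re]

lemma reTrace_cfc_mul_cfc {A B : Matrix ι ι ℂ} (hA : A.IsHermitian) (hB : B.IsHermitian)
    (f g : ℝ → ℝ) :
    reTrace (cfc f A * cfc g B) =
      ∑ i, ∑ j, f (hA.eigenvalues i) * g (hB.eigenvalues j) * ‖eigenCoeff hA hB 1 i j‖ ^ 2 := by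
  simpa using reTrace_conj_cfc_mul_cfc hA hB 1 f g

lemma reTrace_cfc {A : Matrix ι ι ℂ} (hA : A.IsHermitian) (f : ℝ → ℝ) :
    reTrace (cfc f A) = ∑ i, f (hA.eigenvalues i) := by
  rw [reTrace, hA.cfc_eq_mul_diagonal_mul, Matrix.trace_mul_comm, ← mul_assoc,
    hA.eigenvectorUnitary_conjTranspose_mul, one_mul, trace_diagonal, ← Complex.ofReal_sum,
    Complex.ofReal_re]

/-- Pointwise inequalities between products of functions on `[0, ∞)` transfer to traces. -/
lemma reTrace_cfc_mul_cfc_le {A B : Matrix ι ι ℂ} (hA : A.PosSemidef) (hB : B.PosSemidef)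
    {f g f₁ g₁ f₂ g₂ : ℝ → ℝ} {c₁ c₂ : ℝ}
    (h : ∀ x y, 0 ≤ x → 0 ≤ y → f x * g y ≤ c₁ * (f₁ x * g₁ y) + c₂ * (f₂ x * g₂ y)) :
    reTrace (cfc f A * cfc g B) ≤
      c₁ * reTrace (cfc f₁ A * cfc g₁ B) + c₂ * reTrace (cfc f₂ A * cfc g₂ B) := by
  simp only [reTrace_cfc_mul_cfc hA.1 hB.1, Finset.mul_sum, ← Finset.sum_add_distrib]
  refine Finset.sum_le_sum fun i _ => Finset.sum_le_sum fun j _ => ?_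
  have := mul_le_mul_of_nonneg_right (h _ _ (hA.eigenvalues_nonneg i) (hB.eigenvalues_nonneg j))
    (sq_nonneg ‖eigenCoeff hA.1 hB.1 1 i j‖)
  linarith

lemma cfc_mul_rpow {A : Matrix ι ι ℂ} (hA : A.PosSemidef) {r : ℝ} (hr : 0 ≤ r) :
    A * cfc (fun x : ℝ => x ^ r) A = cfc (fun x : ℝ => x ^ (r + 1)) A := by
  nth_rewrite 1 [← cfc_id' ℝ A hA.1.isSelfAdjoint]
  rw [← cfc_mul _ _ A (continuousOn_spectrum_real _ A) (continuousOn_spectrum_real _ A)]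
  refine cfc_congr fun x hx => ?_
  rw [hA.1.spectrum_real_eq_range_eigenvalues] at hx
  obtain ⟨i, rfl⟩ := hx
  rw [Real.rpow_add_one' (hA.eigenvalues_nonneg i) (by positivity), mul_comm]

end SpectralTrace

section Exchange

variable {ι : Type*} [Fintype ι] [DecidableEq ι]

lemma eigenCoeff_sub_self {A B : Matrix ι ι ℂ} (hA : A.IsHermitian) (hB : B.IsHermitian)
    (i j : ι) :
    eigenCoeff hA hB (A - B) i j =
      ((hA.eigenvalues i - hB.eigenvalues j : ℝ) : ℂ) * eigenCoeff hA hB 1 i j := by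
  have h : eigenCoeff hA hB (A - B) =
      diagonal (fun i => (hA.eigenvalues i : ℂ)) * eigenCoeff hA hB 1 -
        eigenCoeff hA hB 1 * diagonal (fun i => (hB.eigenvalues i : ℂ)) := by
    have h1 : (hA.eigenvectorUnitary : Matrix ι ι ℂ)ᴴ * A =
        diagonal (fun i => (hA.eigenvalues i : ℂ)) *
          (hA.eigenvectorUnitary : Matrix ι ι ℂ)ᴴ := by
      have := congrArg ((hA.eigenvectorUnitary : Matrix ι ι ℂ)ᴴ * ·) hA.eq_mul_diagonal_mul
      simpa only [← mul_assoc, hA.eigenvectorUnitary_conjTranspose_mul, one_mul] using this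
    have h2 : B * (hB.eigenvectorUnitary : Matrix ι ι ℂ) =
        (hB.eigenvectorUnitary : Matrix ι ι ℂ) * diagonal (fun i => (hB.eigenvalues i : ℂ)) := by
      have := congrArg (· * (hB.eigenvectorUnitary : Matrix ι ι ℂ)) hB.eq_mul_diagonal_mul
      simpa only [mul_assoc, hB.eigenvectorUnitary_conjTranspose_mul, mul_one] using this
    simp only [eigenCoeff, mul_one]
    rw [mul_sub, sub_mul, h1, mul_assoc _ B, h2]
    simp only [mul_assoc]
  rw [h, Matrix.sub_apply, diagonal_mul, mul_diagonal]
  push_cast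
  ring

lemma reTrace_sub_mul_cfc_sub {A B : Matrix ι ι ℂ} (hA : A.IsHermitian) (hB : B.IsHermitian)
    (f : ℝ → ℝ) :
    reTrace ((A - B) * (cfc f A - cfc f B)) =
      ∑ i, ∑ j, (hA.eigenvalues i - hB.eigenvalues j) *
        (f (hA.eigenvalues i) - f (hB.eigenvalues j)) * ‖eigenCoeff hA hB 1 i j‖ ^ 2 := by
  have hAA : reTrace (A * cfc f A) =
      reTrace (cfc (fun x => x * f x) A * cfc (fun _ : ℝ => (1 : ℝ)) B) := by
    rw [cfc_const_one ℝ B hB.isSelfAdjoint, mul_one,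
      cfc_mul (fun x => x) f A (continuousOn_spectrum_real _ A) (continuousOn_spectrum_real _ A),
      cfc_id' ℝ A hA.isSelfAdjoint]
  have hBB : reTrace (B * cfc f B) =
      reTrace (cfc (fun _ : ℝ => (1 : ℝ)) A * cfc (fun x => x * f x) B) := by
    rw [cfc_const_one ℝ A hA.isSelfAdjoint, one_mul,
      cfc_mul (fun x => x) f B (continuousOn_spectrum_real _ B) (continuousOn_spectrum_real _ B),
      cfc_id' ℝ B hB.isSelfAdjoint]
  have hAB : reTrace (A * cfc f B) = reTrace (cfc (fun x : ℝ => x) A * cfc f B) := by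
    rw [cfc_id' ℝ A hA.isSelfAdjoint]
  have hBA : reTrace (B * cfc f A) = reTrace (cfc f A * cfc (fun x : ℝ => x) B) := by
    rw [cfc_id' ℝ B hB.isSelfAdjoint, reTrace_mul_comm]
  rw [sub_mul, mul_sub, mul_sub, reTrace_sub, reTrace_sub, reTrace_sub, hAA, hAB, hBA, hBB]
  simp only [reTrace_cfc_mul_cfc hA hB, ← Finset.sum_sub_distrib]
  refine Finset.sum_congr rfl fun i _ => Finset.sum_congr rfl fun j _ => ?_
  ring

lemma reTrace_mul_self_mul_cfc_right {A B X : Matrix ι ι ℂ} (hA : A.IsHermitian)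
    (hB : B.IsHermitian) (hX : X.IsHermitian) (g : ℝ → ℝ) :
    reTrace (X * X * cfc g B) =
      ∑ i, ∑ j, g (hB.eigenvalues j) * ‖eigenCoeff hA hB X i j‖ ^ 2 := by
  have h := reTrace_conj_cfc_mul_cfc hA hB X (fun _ => 1) g
  rw [cfc_const_one ℝ A hA.isSelfAdjoint, hX.eq, mul_one] at h
  simpa using h

lemma reTrace_mul_self_mul_cfc_left {A B X : Matrix ι ι ℂ} (hA : A.IsHermitian)
    (hB : B.IsHermitian) (hX : X.IsHermitian) (f : ℝ → ℝ) :
    reTrace (X * X * cfc f A) =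
      ∑ i, ∑ j, f (hA.eigenvalues i) * ‖eigenCoeff hA hB X i j‖ ^ 2 := by
  have h := reTrace_conj_cfc_mul_cfc hA hB X f (fun _ => 1)
  rw [cfc_const_one ℝ B hB.isSelfAdjoint, hX.eq, mul_one, reTrace_mul_comm, ← mul_assoc] at h
  simpa using h

lemma norm_eigenCoeff_sub_sq_le {A B : Matrix ι ι ℂ} (hA : A.IsHermitian) (hB : B.IsHermitian)
    {X Y : Matrix ι ι ℂ} (h : A - B = X - Y) (i j : ι) :
    (hA.eigenvalues i - hB.eigenvalues j) ^ 2 * ‖eigenCoeff hA hB 1 i j‖ ^ 2 ≤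
      2 * ‖eigenCoeff hA hB X i j‖ ^ 2 + 2 * ‖eigenCoeff hA hB Y i j‖ ^ 2 := by
  have h1 := eigenCoeff_sub_self hA hB i j
  have h2 : eigenCoeff hA hB (X - Y) i j = eigenCoeff hA hB X i j - eigenCoeff hA hB Y i j := by
    simp [eigenCoeff, mul_sub, sub_mul]
  rw [h, h2] at h1
  have h3 := congrArg (fun z : ℂ => ‖z‖ ^ 2) h1
  simp only [norm_mul, Complex.norm_real, mul_pow, Real.norm_eq_abs, sq_abs] at h3
  rw [← h3]
  have h4 := norm_sub_le (eigenCoeff hA hB X i j) (eigenCoeff hA hB Y i j)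
  have h5 := pow_le_pow_left₀ (norm_nonneg _) h4 2
  nlinarith [sq_nonneg (‖eigenCoeff hA hB X i j‖ - ‖eigenCoeff hA hB Y i j‖)]

lemma rpow_sub_rpow_le_of_one_le {x y r : ℝ} (hr : 1 ≤ r) (hy : 0 ≤ y) (hxy : y ≤ x) :
    x ^ r - y ^ r ≤ r * x ^ (r - 1) * (x - y) := by
  rcases hy.eq_or_lt with rfl | hy0
  · rcases hxy.eq_or_lt with rfl | hx
    · simp
    · rw [Real.zero_rpow (by linarith), sub_zero, sub_zero, mul_assoc,
        ← Real.rpow_add_one hx.ne', sub_add_cancel]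
      exact le_mul_of_one_le_left (Real.rpow_nonneg hx.le _) hr
  · have hx : 0 < x := hy0.trans_le hxy
    have h := one_add_mul_self_le_rpow_one_add (s := y / x - 1)
      (by have : 0 ≤ y / x := by positivity
          linarith) hr
    rw [add_sub_cancel, Real.div_rpow hy hx.le, le_div_iff₀ (Real.rpow_pos_of_pos hx _)] at h
    have h2 : x ^ r = x ^ (r - 1) * x := by rw [← Real.rpow_add_one hx.ne', sub_add_cancel]
    have h3 : (1 + r * (y / x - 1)) * x ^ r = x ^ r - r * x ^ (r - 1) * (x - y) := by
      rw [h2]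
      field_simp
      ring
    linarith

lemma sub_mul_rpow_sub_le_of_one_le {x y r : ℝ} (hr : 1 ≤ r) (hx : 0 ≤ x) (hy : 0 ≤ y) :
    (x - y) * (x ^ r - y ^ r) ≤ r * (x ^ (r - 1) + y ^ (r - 1)) * (x - y) ^ 2 := by
  wlog hxy : y ≤ x generalizing x y
  · have := this hy hx (le_of_not_ge hxy)
    linarith
  have h := mul_le_mul_of_nonneg_left (rpow_sub_rpow_le_of_one_le hr hy hxy) (sub_nonneg.2 hxy)
  have h2 : 0 ≤ r * y ^ (r - 1) * (x - y) ^ 2 := by positivity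
  linarith

lemma rpow_sub_rpow_le_of_lt_one {x y r : ℝ} (hr : r < 1) (hy : 0 < y) (hxy : y ≤ x) :
    x ^ r - y ^ r ≤ x ^ (r - 1) * (x - y) := by
  have hx : 0 < x := hy.trans_le hxy
  have h1 : x ^ r = x ^ (r - 1) * x := by rw [← Real.rpow_add_one hx.ne', sub_add_cancel]
  have h2 : y ^ r = y ^ (r - 1) * y := by rw [← Real.rpow_add_one hy.ne', sub_add_cancel]
  have h3 : x ^ (r - 1) ≤ y ^ (r - 1) := Real.rpow_le_rpow_of_nonpos hy hxy (by linarith)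
  rw [h1, h2]
  nlinarith

lemma reTrace_exchange_le_of_one_le {S S' a a' : Matrix ι ι ℂ} (hS : S.PosSemidef)
    (hS' : S'.PosSemidef) (ha : a.IsHermitian) (ha' : a'.IsHermitian) (h : S - S' = a - a')
    {r : ℝ} (hr : 1 ≤ r) :
    reTrace ((a - a') * (cfc (fun x : ℝ => x ^ r) S - cfc (fun x : ℝ => x ^ r) S')) ≤
      2 * r * (reTrace (a * a * cfc (fun x : ℝ => x ^ (r - 1)) S) +
        reTrace (a * a * cfc (fun x : ℝ => x ^ (r - 1)) S') +
        reTrace (a' * a' * cfc (fun x : ℝ => x ^ (r - 1)) S) +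
        reTrace (a' * a' * cfc (fun x : ℝ => x ^ (r - 1)) S')) := by
  rw [← h, reTrace_sub_mul_cfc_sub hS.1 hS'.1, reTrace_mul_self_mul_cfc_left hS.1 hS'.1 ha,
    reTrace_mul_self_mul_cfc_left hS.1 hS'.1 ha', reTrace_mul_self_mul_cfc_right hS.1 hS'.1 ha,
    reTrace_mul_self_mul_cfc_right hS.1 hS'.1 ha']
  simp only [← Finset.sum_add_distrib, Finset.mul_sum]
  refine Finset.sum_le_sum fun i _ => Finset.sum_le_sum fun j _ => ?_
  have hx := hS.eigenvalues_nonneg i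
  have hy := hS'.eigenvalues_nonneg j
  have h1 := mul_le_mul_of_nonneg_right (sub_mul_rpow_sub_le_of_one_le hr hx hy)
    (sq_nonneg ‖eigenCoeff hS.1 hS'.1 1 i j‖)
  have h2 := mul_le_mul_of_nonneg_left (norm_eigenCoeff_sub_sq_le hS.1 hS'.1 h i j)
    (show 0 ≤ r * (hS.1.eigenvalues i ^ (r - 1) + hS'.1.eigenvalues j ^ (r - 1)) by positivity)
  linarith

lemma eigenCoeff_eq_zero_of_left {A B X : Matrix ι ι ℂ} (hA : A.IsHermitian) (hB : B.IsHermitian)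
    (hX : X.PosSemidef) (hAX : (A - X).PosSemidef) {i : ι} (hi : hA.eigenvalues i = 0) (j : ι) :
    eigenCoeff hA hB X i j = 0 := by
  set u : ι → ℂ := fun k => (hA.eigenvectorUnitary : Matrix ι ι ℂ) k i with hu
  have hAu : A *ᵥ u = 0 := by
    have := hA.mulVec_eigenvectorBasis i
    rw [hi, zero_smul] at this
    exact this
  have h0 : star u ⬝ᵥ X *ᵥ u = 0 := by
    refine le_antisymm ?_ (hX.dotProduct_mulVec_nonneg u)
    have := hAX.dotProduct_mulVec_nonneg u
    rw [Matrix.sub_mulVec, hAu, zero_sub, dotProduct_neg] at this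
    exact neg_nonneg.1 this
  have hXu : X *ᵥ u = 0 := (hX.dotProduct_mulVec_zero_iff u).1 h0
  have h1 : ∀ k, ((hA.eigenvectorUnitary : Matrix ι ι ℂ)ᴴ * X) i k = 0 := by
    intro k
    have h2 := congrArg star (congrFun hXu k)
    simp only [mulVec, dotProduct, Pi.zero_apply, star_zero, star_sum, star_mul'] at h2
    rw [Matrix.mul_apply, ← h2]
    refine Finset.sum_congr rfl fun t _ => ?_
    rw [conjTranspose_apply, mul_comm, hX.1.apply]
  rw [eigenCoeff, Matrix.mul_apply]
  simp [h1]

lemma conjTranspose_eigenCoeff {A B X : Matrix ι ι ℂ} (hA : A.IsHermitian) (hB : B.IsHermitian)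
    (hX : X.IsHermitian) : (eigenCoeff hA hB X)ᴴ = eigenCoeff hB hA X := by
  simp [eigenCoeff, conjTranspose_mul, hX.eq, mul_assoc]

lemma eigenCoeff_eq_zero_of_right {A B X : Matrix ι ι ℂ} (hA : A.IsHermitian)
    (hB : B.IsHermitian) (hX : X.PosSemidef) (hBX : (B - X).PosSemidef) {j : ι}
    (hj : hB.eigenvalues j = 0) (i : ι) :
    eigenCoeff hA hB X i j = 0 := by
  rw [← conjTranspose_eigenCoeff hB hA hX.1, conjTranspose_apply,
    eigenCoeff_eq_zero_of_left hB hA hX hBX hj, star_zero]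

lemma reTrace_exchange_le_of_lt_one {S S' a a' : Matrix ι ι ℂ} (hS : S.PosSemidef)
    (hS' : S'.PosSemidef) (ha : a.PosSemidef) (ha' : a'.PosSemidef) (h : S - S' = a - a')
    (hSa : (S - a).PosSemidef) (hSa' : (S' - a').PosSemidef) {r : ℝ} (hr0 : 0 ≤ r) (hr : r < 1) :
    reTrace ((a - a') * (cfc (fun x : ℝ => x ^ r) S - cfc (fun x : ℝ => x ^ r) S')) ≤
      2 * reTrace (a * a * cfc (fun x : ℝ => x ^ (r - 1)) S) +
        2 * reTrace (a' * a' * cfc (fun x : ℝ => x ^ (r - 1)) S') := by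
  rw [← h, reTrace_sub_mul_cfc_sub hS.1 hS'.1, reTrace_mul_self_mul_cfc_left hS.1 hS'.1 ha.1,
    reTrace_mul_self_mul_cfc_right hS.1 hS'.1 ha'.1]
  simp only [← Finset.sum_add_distrib, Finset.mul_sum]
  refine Finset.sum_le_sum fun i _ => Finset.sum_le_sum fun j _ => ?_
  have hx := hS.eigenvalues_nonneg i
  have hy := hS'.eigenvalues_nonneg j
  have hD := norm_eigenCoeff_sub_sq_le hS.1 hS'.1 h i j
  have hX0 := fun hi => eigenCoeff_eq_zero_of_left hS.1 hS'.1 ha hSa (i := i) hi j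
  have hY0 := fun hj => eigenCoeff_eq_zero_of_right hS.1 hS'.1 ha' hSa' (j := j) hj i
  set x := hS.1.eigenvalues i
  set y := hS'.1.eigenvalues j
  set w := ‖eigenCoeff hS.1 hS'.1 1 i j‖ ^ 2 with hw
  have hw0 : 0 ≤ w := sq_nonneg _
  rcases hr0.eq_or_lt with rfl | hr1
  · simp only [Real.rpow_zero, sub_self, mul_zero, zero_mul]
    positivity
  have hzero : ∀ z : ℝ, 0 < z → z * z ^ r = z ^ (r - 1) * z ^ 2 := by
    intro z hz
    rw [Real.rpow_sub_one hz.ne']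
    field_simp
  rcases hx.eq_or_lt with hx0 | hx0
  · rw [hX0 hx0.symm] at hD ⊢
    rcases hy.eq_or_lt with hy0 | hy0
    · rw [hY0 hy0.symm]
      simp [← hx0, ← hy0]
    · rw [← hx0] at hD ⊢
      rw [Real.zero_rpow hr1.ne', norm_zero]
      have := mul_le_mul_of_nonneg_left hD (Real.rpow_nonneg hy (r - 1))
      have h3 := hzero y hy0
      simp only [norm_zero] at this
      calc (0 - y) * (0 - y ^ r) * w = (y * y ^ r) * w := by ring
        _ = y ^ (r - 1) * ((0 - y) ^ 2 * w) := by rw [h3]; ring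
        _ ≤ _ := this
        _ = _ := by ring
  rcases hy.eq_or_lt with hy0 | hy0
  · rw [hY0 hy0.symm] at hD ⊢
    rw [← hy0] at hD ⊢
    rw [Real.zero_rpow hr1.ne', norm_zero]
    have := mul_le_mul_of_nonneg_left hD (Real.rpow_nonneg hx (r - 1))
    have h3 := hzero x hx0
    simp only [norm_zero] at this
    calc (x - 0) * (x ^ r - 0) * w = (x * x ^ r) * w := by ring
      _ = x ^ (r - 1) * ((x - 0) ^ 2 * w) := by rw [h3]; ring
      _ ≤ _ := this
      _ = _ := by ring
  rcases le_total y x with hxy | hxy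
  · have h1 := mul_le_mul_of_nonneg_left (rpow_sub_rpow_le_of_lt_one hr hy0 hxy)
      (sub_nonneg.2 hxy)
    have h2 := mul_le_mul_of_nonneg_right h1 hw0
    have h3 := mul_le_mul_of_nonneg_left hD (Real.rpow_nonneg hx (r - 1))
    have h4 := mul_le_mul_of_nonneg_right
      (Real.rpow_le_rpow_of_nonpos hy0 hxy (show r - 1 ≤ 0 by linarith))
      (sq_nonneg ‖eigenCoeff hS.1 hS'.1 a' i j‖)
    linarith
  · have h1 := mul_le_mul_of_nonneg_left (rpow_sub_rpow_le_of_lt_one hr hx0 hxy)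
      (sub_nonneg.2 hxy)
    have h2 := mul_le_mul_of_nonneg_right h1 hw0
    have h3 := mul_le_mul_of_nonneg_left hD (Real.rpow_nonneg hy (r - 1))
    have h4 := mul_le_mul_of_nonneg_right
      (Real.rpow_le_rpow_of_nonpos hx0 hxy (show r - 1 ≤ 0 by linarith))
      (sq_nonneg ‖eigenCoeff hS.1 hS'.1 a i j‖)
    linarith

end Exchange

section Young

variable {ι : Type*} [Fintype ι] [DecidableEq ι]

/-- Young's inequality with a parameter. -/
lemma mul_rpow_le_add {x y r ε : ℝ} (hx : 0 ≤ x) (hy : 0 ≤ y) (hr : 0 ≤ r) (hε : 0 < ε) :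
    x * y ^ r ≤ ε * y ^ (r + 1) + ε ^ (-r) * x ^ (r + 1) := by
  rw [Real.rpow_add_one' hy (by positivity), Real.rpow_add_one' hx (by positivity)]
  have h1 : 0 ≤ y ^ r := Real.rpow_nonneg hy _
  have h2 : 0 ≤ ε ^ (-r) * (x ^ r * x) := by positivity
  rcases le_total x (ε * y) with h | h
  · have := mul_le_mul_of_nonneg_right h h1
    linarith
  · have h3 : y ≤ x / ε := by rwa [le_div_iff₀ hε, mul_comm]
    have h4 := Real.rpow_le_rpow hy h3 hr
    rw [Real.div_rpow hx hε.le, div_eq_mul_inv, ← Real.rpow_neg hε.le] at h4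
    have h5 := mul_le_mul_of_nonneg_left h4 hx
    have h6 : 0 ≤ ε * (y ^ r * y) := by positivity
    linarith

lemma reTrace_mul_cfc_rpow_le {A B : Matrix ι ι ℂ} (hA : A.PosSemidef) (hB : B.PosSemidef)
    {r ε : ℝ} (hr : 0 ≤ r) (hε : 0 < ε) :
    reTrace (A * cfc (fun x : ℝ => x ^ r) B) ≤
      ε * reTrace (cfc (fun x : ℝ => x ^ (r + 1)) B) +
        ε ^ (-r) * reTrace (cfc (fun x : ℝ => x ^ (r + 1)) A) := by
  have h := reTrace_cfc_mul_cfc_le hA hB (f := fun x => x) (g := fun x => x ^ r)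
    (f₁ := fun _ => 1) (g₁ := fun x => x ^ (r + 1)) (f₂ := fun x => x ^ (r + 1)) (g₂ := fun _ => 1)
    (c₁ := ε) (c₂ := ε ^ (-r))
    (fun x y hx hy => by simpa using mul_rpow_le_add hx hy hr hε)
  rwa [cfc_id' ℝ A hA.1.isSelfAdjoint, cfc_const_one ℝ A hA.1.isSelfAdjoint,
    cfc_const_one ℝ B hB.1.isSelfAdjoint, one_mul, mul_one] at h

lemma cfc_mul_self {A : Matrix ι ι ℂ} (hA : A.IsHermitian) :
    cfc (fun x : ℝ => x * x) A = A * A := by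
  rw [cfc_mul (fun x => x) (fun x => x) A, cfc_id' ℝ A hA.isSelfAdjoint]

lemma reTrace_mul_self_mul_cfc_rpow_le {A B : Matrix ι ι ℂ} (hA : A.PosSemidef)
    (hB : B.PosSemidef) {r ε : ℝ} (hr : 1 ≤ r) (hε : 0 < ε) :
    reTrace (A * A * cfc (fun x : ℝ => x ^ (r - 1)) B) ≤
      ε * reTrace (A * cfc (fun x : ℝ => x ^ r) B) +
        ε ^ (1 - r) * reTrace (cfc (fun x : ℝ => x ^ (r + 1)) A) := by
  have h := reTrace_cfc_mul_cfc_le hA hB (f := fun x => x * x) (g := fun x => x ^ (r - 1))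
    (f₁ := fun x => x) (g₁ := fun x => x ^ r) (f₂ := fun x => x ^ (r + 1)) (g₂ := fun _ => 1)
    (c₁ := ε) (c₂ := ε ^ (1 - r))
    (fun x y hx hy => by
      have h1 := mul_le_mul_of_nonneg_left (mul_rpow_le_add hx hy (sub_nonneg.2 hr) hε) hx
      rw [sub_add_cancel, neg_sub] at h1
      rw [Real.rpow_add_one' hx (by linarith)]
      linarith)
  rwa [cfc_id' ℝ A hA.1.isSelfAdjoint, cfc_mul_self hA.1,
    cfc_const_one ℝ B hB.1.isSelfAdjoint, mul_one] at h

/-- If `0 ≤ a ≤ S` and `e i` is a unit eigenvector of `a` with eigenvalue `α i`, then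
`α i * ⟨e i, S⁻¹ e i⟩ ≤ 1`. -/
lemma eigenvalues_mul_sum_inv_le_one {S a : Matrix ι ι ℂ} (hS : S.PosSemidef)
    (ha : a.PosSemidef) (hSa : (S - a).PosSemidef) (i : ι) :
    ha.1.eigenvalues i *
      ∑ j, (hS.1.eigenvalues j)⁻¹ * ‖eigenCoeff ha.1 hS.1 1 i j‖ ^ 2 ≤ 1 := by
  set R := cfc (fun x : ℝ => x⁻¹) S with hR
  have hRh : R.IsHermitian := cfc_isHermitian _ _
  have hRSR : R * S * R = R := by
    have h : cfc (fun x : ℝ => x⁻¹ * x * x⁻¹) S = R * S * R := by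
      rw [cfc_mul (fun x => x⁻¹ * x) (fun x => x⁻¹) S (continuousOn_spectrum_real _ S)
        (continuousOn_spectrum_real _ S), cfc_mul (fun x => x⁻¹) (fun x => x) S
        (continuousOn_spectrum_real _ S) (continuousOn_spectrum_real _ S),
        cfc_id' ℝ S hS.1.isSelfAdjoint]
    rw [← h, hR]
    congr 1
    funext x
    rcases eq_or_ne x 0 with rfl | hx
    · simp
    · field_simp
  set U := (ha.1.eigenvectorUnitary : Matrix ι ι ℂ) with hU
  set Q := Uᴴ * R * U with hQ
  set c := ∑ j, (hS.1.eigenvalues j)⁻¹ * ‖eigenCoeff ha.1 hS.1 1 i j‖ ^ 2 with hc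
  have hc0 : 0 ≤ c := Finset.sum_nonneg fun j _ =>
    mul_nonneg (inv_nonneg.2 (hS.eigenvalues_nonneg j)) (sq_nonneg _)
  have hQi : Q i i = (c : ℂ) := by
    have h : Q = eigenCoeff ha.1 hS.1 1 *
        diagonal (fun j => (((hS.1.eigenvalues j)⁻¹ : ℝ) : ℂ)) * (eigenCoeff ha.1 hS.1 1)ᴴ := by
      rw [hQ, hR, hS.1.cfc_eq_mul_diagonal_mul]
      simp only [eigenCoeff, conjTranspose_mul, conjTranspose_conjTranspose, mul_assoc, one_mul,
        hU]
    rw [h, Matrix.mul_apply, hc]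
    push_cast
    refine Finset.sum_congr rfl fun j _ => ?_
    have := Complex.mul_conj' (eigenCoeff ha.1 hS.1 1 i j)
    rw [mul_diagonal, conjTranspose_apply, ← this, ← starRingEnd_apply]
    ring
  have hQh : Q.IsHermitian := by
    rw [hQ]
    exact isHermitian_conjTranspose_mul_mul U hRh
  have hpos : (Q - Q * diagonal (fun j => (ha.1.eigenvalues j : ℂ)) * Q).PosSemidef := by
    have h := (hSa.conjTranspose_mul_mul_same R).conjTranspose_mul_mul_same U
    rw [hRh.eq, mul_sub, sub_mul, hRSR, mul_sub, sub_mul] at h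
    convert h using 2
    conv_rhs => enter [1, 2, 1, 2]; rw [ha.1.eq_mul_diagonal_mul]
    simp only [hQ, hU, mul_assoc]
  have hdiag := hpos.diag_nonneg (i := i)
  rw [Matrix.sub_apply, hQi, Matrix.mul_apply] at hdiag
  have hre := (Complex.le_def.1 hdiag).1
  have hterm : ∀ j, (Q * diagonal (fun j => (ha.1.eigenvalues j : ℂ))) i j * Q j i =
      ((ha.1.eigenvalues j * ‖Q i j‖ ^ 2 : ℝ) : ℂ) := by
    intro j
    have := Complex.mul_conj' (Q i j)
    rw [mul_diagonal, ← hQh.apply j i, ← starRingEnd_apply]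
    push_cast
    rw [← this]
    ring
  simp only [hterm] at hre
  rw [← Complex.ofReal_sum, ← Complex.ofReal_sub, Complex.ofReal_re, Complex.zero_re] at hre
  have hsingle := Finset.single_le_sum
    (f := fun j => ha.1.eigenvalues j * ‖Q i j‖ ^ 2)
    (fun j _ => mul_nonneg (ha.eigenvalues_nonneg j) (sq_nonneg _)) (Finset.mem_univ i)
  simp only [hQi, Complex.norm_real, Real.norm_eq_abs, sq_abs] at hsingle
  by_contra! hlt
  have hcpos : 0 < c := by
    rcases hc0.eq_or_lt with h | h
    · rw [← h] at hlt
      linarith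
    · exact h
  nlinarith

lemma reTrace_mul_self_mul_cfc_rpow_le_of_le {S a : Matrix ι ι ℂ} (hS : S.PosSemidef)
    (ha : a.PosSemidef) (hSa : (S - a).PosSemidef) {r : ℝ} (hr0 : 0 ≤ r) (hr : r < 1) :
    reTrace (a * a * cfc (fun x : ℝ => x ^ (r - 1)) S) ≤
      2 * reTrace (cfc (fun x : ℝ => x ^ (r + 1)) a) := by
  have h := reTrace_cfc_mul_cfc_le ha hS (f := fun x => x * x) (g := fun x => x ^ (r - 1))
    (f₁ := fun x => x ^ (r + 1) * x) (g₁ := fun x => x⁻¹) (f₂ := fun x => x ^ (r + 1))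
    (g₂ := fun _ => 1) (c₁ := 1) (c₂ := 1)
    (fun x y hx hy => by
      rcases hy.eq_or_lt with rfl | hy0
      · rw [Real.zero_rpow (by linarith)]
        have := Real.rpow_nonneg hx (r + 1)
        simpa using this
      rcases hx.eq_or_lt with rfl | hx0
      · simp [Real.zero_rpow (show r + 1 ≠ 0 by linarith)]
      rw [one_mul, one_mul, mul_one, Real.rpow_add_one hx0.ne']
      rcases le_total x y with hxy | hxy
      · have h1 := Real.rpow_le_rpow_of_nonpos hx0 hxy (show r - 1 ≤ 0 by linarith)
        have h2 := mul_le_mul_of_nonneg_left h1 (mul_nonneg hx hx)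
        rw [Real.rpow_sub_one hx0.ne' r] at h2
        have h3 : x * x * (x ^ r / x) = x ^ r * x := by field_simp
        have h4 : 0 ≤ x ^ r * x * x * y⁻¹ := by positivity
        linarith
      · have h1 := Real.rpow_le_rpow hy hxy hr0
        have h2 : y ^ (r - 1) = y ^ r * y⁻¹ := by
          rw [Real.rpow_sub_one hy0.ne', div_eq_mul_inv]
        have h3 := mul_le_mul_of_nonneg_left h1 (show 0 ≤ x * x * y⁻¹ by positivity)
        have h4 : 0 ≤ x ^ r * x := by positivity
        rw [h2]
        linarith)
  rw [cfc_mul_self ha.1, cfc_const_one ℝ S hS.1.isSelfAdjoint, mul_one, one_mul, one_mul] at h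
  have h2 : reTrace (cfc (fun x : ℝ => x ^ (r + 1) * x) a * cfc (fun x : ℝ => x⁻¹) S) ≤
      reTrace (cfc (fun x : ℝ => x ^ (r + 1)) a) := by
    rw [reTrace_cfc ha.1, reTrace_cfc_mul_cfc ha.1 hS.1]
    refine Finset.sum_le_sum fun i _ => ?_
    have h4 := mul_le_mul_of_nonneg_left (eigenvalues_mul_sum_inv_le_one hS ha hSa i)
      (Real.rpow_nonneg (ha.eigenvalues_nonneg i) (r + 1))
    rw [mul_one, ← mul_assoc, Finset.mul_sum] at h4
    simpa only [mul_assoc] using h4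
  linarith

end Young

section Amplification

variable {ι κ : Type*} [Fintype ι] [Fintype κ]

lemma reTrace_submatrix_equiv (e : κ ≃ ι) (A : Matrix ι ι ℂ) :
    reTrace (A.submatrix e e) = reTrace A := by
  simp only [reTrace, Matrix.trace, diag_apply, submatrix_apply]
  rw [Equiv.sum_comp e (fun i => A i i)]

lemma reTrace_kronecker_one [DecidableEq κ] (A : Matrix ι ι ℂ) :
    reTrace (A ⊗ₖ (1 : Matrix κ κ ℂ)) = Fintype.card κ * reTrace A := by
  rw [reTrace, trace_kronecker, trace_one, mul_comm, reTrace]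
  simp

/-- Pairing with `B ⊗ 1` only sees the partial trace. -/
lemma reTrace_mul_kronecker_one [DecidableEq κ] (A : Matrix (ι × κ) (ι × κ) ℂ) (B : Matrix ι ι ℂ) :
    reTrace (A * (B ⊗ₖ (1 : Matrix κ κ ℂ))) =
      reTrace ((Matrix.of fun i j => ∑ x, A (i, x) (j, x)) * B) := by
  simp only [reTrace, Matrix.trace, diag_apply, Matrix.mul_apply, kronecker_apply, of_apply,
    Fintype.sum_prod_type, Matrix.one_apply, mul_ite, mul_one, mul_zero, Finset.sum_ite_eq',
    Finset.mem_univ, if_true, Finset.sum_mul]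
  congr 1
  exact Finset.sum_congr rfl fun i _ => Finset.sum_comm

variable [DecidableEq ι] [DecidableEq κ]

lemma cfc_submatrix_equiv (e : κ ≃ ι) {A : Matrix ι ι ℂ} (hA : A.IsHermitian) (f : ℝ → ℝ) :
    cfc f (A.submatrix e e) = (cfc f A).submatrix e e := by
  let φ : Matrix ι ι ℂ →⋆ₐ[ℂ] Matrix κ κ ℂ :=
    { toFun := fun M => M.submatrix e e
      map_one' := submatrix_one_equiv e
      map_mul' := fun M N => (submatrix_mul_equiv M N e e e).symm
      map_zero' := rfl
      map_add' := fun _ _ => rfl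
      commutes' := fun c => by
        simp only [Algebra.algebraMap_eq_smul_one, submatrix_smul, Pi.smul_apply,
          submatrix_one_equiv]
      map_star' := fun _ => rfl }
  exact (StarAlgHom.map_cfc φ f A (continuousOn_spectrum_real f A)
    (continuous_id.matrix_submatrix e e) hA.isSelfAdjoint (hA.submatrix e).isSelfAdjoint).symm

lemma cfc_kronecker_one {A : Matrix ι ι ℂ} (hA : A.IsHermitian) (f : ℝ → ℝ) :
    cfc f (A ⊗ₖ (1 : Matrix κ κ ℂ)) = cfc f A ⊗ₖ (1 : Matrix κ κ ℂ) := by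
  let φ : Matrix ι ι ℂ →⋆ₐ[ℂ] Matrix (ι × κ) (ι × κ) ℂ :=
    { toFun := fun M => M ⊗ₖ (1 : Matrix κ κ ℂ)
      map_one' := one_kronecker_one
      map_mul' := fun M N => by rw [← mul_kronecker_mul, one_mul]
      map_zero' := zero_kronecker _
      map_add' := fun M N => add_kronecker M N _
      commutes' := fun c => by
        simp only [Algebra.algebraMap_eq_smul_one, smul_kronecker, one_kronecker_one]
      map_star' := fun M => by
        simp only [star_eq_conjTranspose, conjTranspose_kronecker, conjTranspose_one] }
  have hφ : Continuous φ := by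
    refine continuous_matrix fun i j => ?_
    exact (continuous_id.matrix_elem i.1 j.1).mul continuous_const
  have hφA : (A ⊗ₖ (1 : Matrix κ κ ℂ)).IsHermitian := by
    rw [Matrix.IsHermitian, conjTranspose_kronecker, hA.eq, conjTranspose_one]
  exact (StarAlgHom.map_cfc φ f A (continuousOn_spectrum_real f A) hφ hA.isSelfAdjoint
    hφA.isSelfAdjoint).symm

lemma reTrace_cfc_nonneg {A : Matrix ι ι ℂ} (hA : A.PosSemidef) (p : ℝ) :
    0 ≤ reTrace (cfc (fun x : ℝ => x ^ p) A) := by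
  rw [reTrace_cfc hA.1]
  exact Finset.sum_nonneg fun i _ => Real.rpow_nonneg (hA.eigenvalues_nonneg i) p

lemma ntrNorm_eq {A : Matrix ι ι ℂ} (hA : A.PosSemidef) (p : ℝ) :
    ntrNorm p A = (reTrace (cfc (fun x : ℝ => x ^ p) A) / Fintype.card ι) ^ (1 / p) := by
  have h : ∑ j, ctmEig A j ^ (p / 2) = reTrace (cfc (fun x : ℝ => x ^ p) A) := by
    have h1 := reTrace_cfc (posSemidef_conjTranspose_mul_self A).isHermitian
      (fun x => x ^ (p / 2))
    simp only [ctmEig]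
    rw [← h1, hA.1.eq, ← cfc_mul_self hA.1,
      ← cfc_comp' (fun x : ℝ => x ^ (p / 2)) (fun x => x * x) A
        ((A.finite_real_spectrum.image _).continuousOn _) (continuousOn_spectrum_real _ A)
        hA.1.isSelfAdjoint]
    congr 1
    refine cfc_congr fun x hx => ?_
    rw [hA.1.spectrum_real_eq_range_eigenvalues] at hx
    obtain ⟨i, rfl⟩ := hx
    have h0 := hA.eigenvalues_nonneg i
    rw [← sq, ← Real.rpow_natCast, ← Real.rpow_mul h0]
    congr 1
    push_cast
    ring
  rw [ntrNorm, h]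

lemma ntrNorm_zero {p : ℝ} (hp : 1 ≤ p) : ntrNorm p (0 : Matrix ι ι ℂ) = 0 := by
  have hp0 : p ≠ 0 := by linarith
  rw [ntrNorm_eq PosSemidef.zero, cfc_apply_zero]
  simp [Real.zero_rpow hp0, reTrace, hp0]

end Amplification

section Involution

variable {ι : Type*} [Fintype ι] [DecidableEq ι]

lemma reTrace_mul_cfc_le_of_involutive_of_lt_one {S a : Matrix ι ι ℂ} {e : ι ≃ ι}
    (he : Function.Involutive e) (hS : S.PosSemidef) (ha : a.PosSemidef)
    (hSa : (S - a).PosSemidef) (h : S - S.submatrix e e = a - a.submatrix e e)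
    {r : ℝ} (hr0 : 0 ≤ r) (hr : r < 1) :
    reTrace (a * cfc (fun x : ℝ => x ^ r) S) ≤
      reTrace (a.submatrix e e * cfc (fun x : ℝ => x ^ r) S) +
        4 * reTrace (cfc (fun x : ℝ => x ^ (r + 1)) a) := by
  have hSa' : (S.submatrix e e - a.submatrix e e).PosSemidef := hSa.submatrix e
  have hinv : ∀ M : Matrix ι ι ℂ, (M.submatrix e e).submatrix e e = M := fun M => by
    ext i j
    simp [he i, he j]
  have hmul : ∀ M N : Matrix ι ι ℂ,
      reTrace (M.submatrix e e * N.submatrix e e) = reTrace (M * N) := fun M N => by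
    rw [submatrix_mul_equiv, reTrace_submatrix_equiv]
  have h1 := reTrace_exchange_le_of_lt_one hS (hS.submatrix e) ha (ha.submatrix e) h hSa hSa' hr0 hr
  have h2 := reTrace_mul_self_mul_cfc_rpow_le_of_le hS ha hSa hr0 hr
  rw [cfc_submatrix_equiv e hS.1, cfc_submatrix_equiv e hS.1, submatrix_mul_equiv, hmul, sub_mul,
    mul_sub, mul_sub, reTrace_sub, reTrace_sub, reTrace_sub, hmul] at h1
  have h3 := hmul (a.submatrix e e) (cfc (fun x : ℝ => x ^ r) S)
  rw [hinv] at h3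
  linarith

lemma reTrace_mul_cfc_le_of_involutive_of_one_le {S a : Matrix ι ι ℂ} {e : ι ≃ ι}
    (he : Function.Involutive e) (hS : S.PosSemidef) (ha : a.PosSemidef)
    (h : S - S.submatrix e e = a - a.submatrix e e)
    {r ε : ℝ} (hr : 1 ≤ r) (hε : 0 < ε) :
    reTrace (a * cfc (fun x : ℝ => x ^ r) S) ≤
      reTrace (a.submatrix e e * cfc (fun x : ℝ => x ^ r) S) +
        2 * r * (ε * (reTrace (a * cfc (fun x : ℝ => x ^ r) S) +
          reTrace (a.submatrix e e * cfc (fun x : ℝ => x ^ r) S)) +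
          2 * ε ^ (1 - r) * reTrace (cfc (fun x : ℝ => x ^ (r + 1)) a)) := by
  have hinv : ∀ M : Matrix ι ι ℂ, (M.submatrix e e).submatrix e e = M := fun M => by
    ext i j
    simp [he i, he j]
  have hmul : ∀ M N : Matrix ι ι ℂ,
      reTrace (M.submatrix e e * N.submatrix e e) = reTrace (M * N) := fun M N => by
    rw [submatrix_mul_equiv, reTrace_submatrix_equiv]
  have h1 := reTrace_exchange_le_of_one_le hS (hS.submatrix e) ha.1 (ha.submatrix e).1 h hr
  have h2 := reTrace_mul_self_mul_cfc_rpow_le ha hS hr hε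
  have h2' := reTrace_mul_self_mul_cfc_rpow_le (ha.submatrix e) hS hr hε
  rw [cfc_submatrix_equiv e ha.1, reTrace_submatrix_equiv] at h2'
  rw [cfc_submatrix_equiv e hS.1, cfc_submatrix_equiv e hS.1, sub_mul, mul_sub, mul_sub,
    reTrace_sub, reTrace_sub, reTrace_sub, hmul] at h1
  set X := cfc (fun x : ℝ => x ^ (r - 1)) S
  have h3 := hmul (a.submatrix e e) (cfc (fun x : ℝ => x ^ r) S)
  have h4 : reTrace (a.submatrix e e * a.submatrix e e * X.submatrix e e) =
      reTrace (a * a * X) := by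
    rw [submatrix_mul_equiv, hmul]
  have h5 : reTrace (a * a * X.submatrix e e) =
      reTrace (a.submatrix e e * a.submatrix e e * X) := by
    rw [← hmul, hinv, ← submatrix_mul_equiv a a e e e]
  rw [hinv] at h3
  have hr0 : 0 ≤ 2 * r := by linarith
  have h6 := mul_le_mul_of_nonneg_left (add_le_add h2 h2') hr0
  rw [h3, h4, h5] at h1
  linarith

end Involution

section TensorLegs

variable {m l n : ℕ}

lemma ampl_apply (k : Fin n) (a : Matrix (Fin m × Fin l) (Fin m × Fin l) ℂ)
    (u v : Fin m) (f g : Fin n → Fin l) [Decidable (∀ j, j ≠ k → f j = g j)] :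
    ampl m l n k a (u, f) (v, g) =
      if ∀ j, j ≠ k → f j = g j then a (u, f k) (v, g k) else 0 := by
  simp only [ampl, of_apply]

lemma ampl_posSemidef (k : Fin n) {a : Matrix (Fin m × Fin l) (Fin m × Fin l) ℂ}
    (ha : a.PosSemidef) : (ampl m l n k a).PosSemidef := by
  classical
  have h : ampl m l n k a = (a ⊗ₖ (1 : Matrix ({j // j ≠ k} → Fin l)
      ({j // j ≠ k} → Fin l) ℂ)).submatrix (fun P => ((P.1, P.2 k), fun j => P.2 j))
      (fun P => ((P.1, P.2 k), fun j => P.2 j)) := by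
    ext ⟨u, f⟩ ⟨v, g⟩
    simp [ampl_apply, Matrix.one_apply, funext_iff]
  rw [h]
  exact (ha.kronecker PosSemidef.one).submatrix _

/-- Move an additional tensor leg next to the first one. -/
def outerLeg (α β γ : Type*) : (α × β) × γ ≃ (α × γ) × β where
  toFun P := ((P.1.1, P.2), P.1.2)
  invFun P := ((P.1.1, P.2), P.1.2)
  left_inv _ := rfl
  right_inv _ := rfl

lemma outerLeg_apply {α β γ : Type*} (u : α) (f : β) (x : γ) :
    outerLeg α β γ ((u, f), x) = ((u, x), f) := rfl

/-- Exchange the `k`-th tensor leg with an additional one. -/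
def swapLeg (m l : ℕ) {n : ℕ} (k : Fin n) :
    (Fin m × (Fin n → Fin l)) × Fin l ≃ (Fin m × (Fin n → Fin l)) × Fin l :=
  Function.Involutive.toPerm
    (fun P => ((P.1.1, Function.update P.1.2 k P.2), P.1.2 k)) (by
      rintro ⟨⟨u, f⟩, x⟩
      simp)

lemma swapLeg_involutive (k : Fin n) : Function.Involutive (swapLeg m l k) :=
  Function.Involutive.toPerm_involutive _

lemma swapLeg_apply (k : Fin n) (u : Fin m) (f : Fin n → Fin l) (x : Fin l) :
    swapLeg m l k ((u, f), x) = ((u, Function.update f k x), f k) := rfl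

lemma ampl_kronecker_one_submatrix_swapLeg (k : Fin n)
    (a : Matrix (Fin m × Fin l) (Fin m × Fin l) ℂ) :
    (ampl m l n k a ⊗ₖ (1 : Matrix (Fin l) (Fin l) ℂ)).submatrix (swapLeg m l k)
        (swapLeg m l k) =
      (a ⊗ₖ (1 : Matrix (Fin n → Fin l) (Fin n → Fin l) ℂ)).submatrix
        (outerLeg _ _ _) (outerLeg _ _ _) := by
  ext ⟨⟨u, f⟩, x⟩ ⟨⟨v, g⟩, y⟩
  have h1 : (∀ j, j ≠ k → Function.update f k x j = Function.update g k y j) ↔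
      ∀ j, j ≠ k → f j = g j :=
    forall₂_congr fun j hj => by
      rw [Function.update_of_ne hj, Function.update_of_ne hj]
  have h2 : f = g ↔ (∀ j, j ≠ k → f j = g j) ∧ f k = g k := by
    refine ⟨fun h => h ▸ ⟨fun _ _ => rfl, rfl⟩, fun h => funext fun j => ?_⟩
    by_cases hj : j = k
    · exact hj ▸ h.2
    · exact h.1 j hj
  classical
  simp only [submatrix_apply, swapLeg_apply, kronecker_apply, ampl_apply, Matrix.one_apply, h1,
    outerLeg_apply, Function.update_self]
  rw [ite_cond_congr (propext h2)]
  split_ifs <;> simp_all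

lemma ampl_kronecker_one_submatrix_swapLeg_of_ne {j k : Fin n} (hjk : j ≠ k)
    (a : Matrix (Fin m × Fin l) (Fin m × Fin l) ℂ) :
    (ampl m l n j a ⊗ₖ (1 : Matrix (Fin l) (Fin l) ℂ)).submatrix (swapLeg m l k)
        (swapLeg m l k) = ampl m l n j a ⊗ₖ (1 : Matrix (Fin l) (Fin l) ℂ) := by
  ext ⟨⟨u, f⟩, x⟩ ⟨⟨v, g⟩, y⟩
  have h : ((∀ i, i ≠ j → Function.update f k x i = Function.update g k y i) ∧ f k = g k) ↔
      (∀ i, i ≠ j → f i = g i) ∧ x = y := by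
    constructor
    · rintro ⟨h1, h2⟩
      refine ⟨fun i hi => ?_, by simpa using h1 k hjk.symm⟩
      by_cases hik : i = k
      · exact hik ▸ h2
      · simpa [hik] using h1 i hi
    · rintro ⟨h1, rfl⟩
      refine ⟨fun i hi => ?_, h1 k hjk.symm⟩
      by_cases hik : i = k
      · subst hik
        simp
      · simpa [hik] using h1 i hi
  classical
  simp only [submatrix_apply, swapLeg_apply, kronecker_apply, ampl_apply, Matrix.one_apply,
    Function.update_of_ne hjk, mul_ite, mul_one, mul_zero, ← ite_and]
  simp only [and_comm] at h
  simp only [h]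

lemma reTrace_cfc_ampl_kronecker_one (k : Fin n)
    {a : Matrix (Fin m × Fin l) (Fin m × Fin l) ℂ} (ha : a.PosSemidef) (f : ℝ → ℝ) :
    reTrace (cfc f (ampl m l n k a ⊗ₖ (1 : Matrix (Fin l) (Fin l) ℂ))) =
      (l : ℝ) ^ n * reTrace (cfc f a) := by
  have hα := (ampl_posSemidef k ha).kronecker (PosSemidef.one (n := Fin l) (R := ℂ))
  have ha1 := ha.kronecker (PosSemidef.one (n := Fin n → Fin l) (R := ℂ))
  rw [← reTrace_submatrix_equiv (swapLeg m l k), ← cfc_submatrix_equiv _ hα.1,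
    ampl_kronecker_one_submatrix_swapLeg, cfc_submatrix_equiv _ ha1.1, reTrace_submatrix_equiv,
    cfc_kronecker_one ha.1, reTrace_kronecker_one]
  simp

lemma reTrace_swapLeg_mul_kronecker_one (k : Fin n)
    (a : Matrix (Fin m × Fin l) (Fin m × Fin l) ℂ)
    (B : Matrix (Fin m × (Fin n → Fin l)) (Fin m × (Fin n → Fin l)) ℂ) :
    reTrace ((ampl m l n k a ⊗ₖ (1 : Matrix (Fin l) (Fin l) ℂ)).submatrix (swapLeg m l k)
        (swapLeg m l k) * (B ⊗ₖ (1 : Matrix (Fin l) (Fin l) ℂ))) =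
      reTrace ((∑ i : Fin l, Matrix.of fun u v : Fin m => a (u, i) (v, i)) ⊗ₖ
        (1 : Matrix (Fin n → Fin l) (Fin n → Fin l) ℂ) * B) := by
  rw [reTrace_mul_kronecker_one, ampl_kronecker_one_submatrix_swapLeg]
  congr 2
  ext ⟨u, f⟩ ⟨v, g⟩
  simp only [of_apply, submatrix_apply, outerLeg_apply, kronecker_apply, Matrix.sum_apply,
    Finset.sum_mul]

lemma reTrace_ampl_kronecker_one_mul (k : Fin n)
    (a : Matrix (Fin m × Fin l) (Fin m × Fin l) ℂ)
    (B : Matrix (Fin m × (Fin n → Fin l)) (Fin m × (Fin n → Fin l)) ℂ) :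
    reTrace ((ampl m l n k a ⊗ₖ (1 : Matrix (Fin l) (Fin l) ℂ)) *
        (B ⊗ₖ (1 : Matrix (Fin l) (Fin l) ℂ))) = l * reTrace (ampl m l n k a * B) := by
  rw [← mul_kronecker_mul, one_mul, reTrace_kronecker_one, Fintype.card_fin]

variable {a : Fin n → Matrix (Fin m × Fin l) (Fin m × Fin l) ℂ}

lemma sum_ampl_posSemidef (ha : ∀ k, (a k).PosSemidef) :
    (∑ k, ampl m l n k (a k)).PosSemidef :=
  posSemidef_sum _ fun k _ => ampl_posSemidef k (ha k)

lemma sum_ampl_sub_posSemidef (ha : ∀ k, (a k).PosSemidef) (k : Fin n) :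
    (∑ j, ampl m l n j (a j) - ampl m l n k (a k)).PosSemidef := by
  rw [← Finset.add_sum_erase _ _ (Finset.mem_univ k), add_sub_cancel_left]
  exact posSemidef_sum _ fun j _ => ampl_posSemidef j (ha j)

lemma sum_ampl_kronecker_one_sub_swapLeg (k : Fin n) :
    (∑ j, ampl m l n j (a j)) ⊗ₖ (1 : Matrix (Fin l) (Fin l) ℂ) -
        ((∑ j, ampl m l n j (a j)) ⊗ₖ (1 : Matrix (Fin l) (Fin l) ℂ)).submatrix
          (swapLeg m l k) (swapLeg m l k) =
      ampl m l n k (a k) ⊗ₖ (1 : Matrix (Fin l) (Fin l) ℂ) -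
        (ampl m l n k (a k) ⊗ₖ (1 : Matrix (Fin l) (Fin l) ℂ)).submatrix
          (swapLeg m l k) (swapLeg m l k) := by
  have h : ((∑ j ∈ Finset.univ.erase k, ampl m l n j (a j)) ⊗ₖ
      (1 : Matrix (Fin l) (Fin l) ℂ)).submatrix (swapLeg m l k) (swapLeg m l k) =
      (∑ j ∈ Finset.univ.erase k, ampl m l n j (a j)) ⊗ₖ (1 : Matrix (Fin l) (Fin l) ℂ) := by
    ext P Q
    rw [submatrix_apply, kronecker_apply, kronecker_apply, Matrix.sum_apply, Matrix.sum_apply,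
      Finset.sum_mul, Finset.sum_mul]
    refine Finset.sum_congr rfl fun j hj => ?_
    exact congrFun₂ (ampl_kronecker_one_submatrix_swapLeg_of_ne (Finset.ne_of_mem_erase hj)
      (a j)) P Q
  rw [← Finset.add_sum_erase _ _ (Finset.mem_univ k), add_kronecker, submatrix_add]
  simp only [Pi.add_apply]
  rw [h]
  abel

/-- The average of the diagonal blocks is positive. -/
lemma inv_smul_sum_diag_posSemidef (ha : ∀ k, (a k).PosSemidef) :
    ((l : ℂ)⁻¹ • ∑ k, ∑ i : Fin l, Matrix.of fun u v : Fin m =>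
      a k (u, i) (v, i)).PosSemidef := by
  have hl : (0 : ℂ) ≤ (l : ℂ)⁻¹ := by
    rw [← Complex.ofReal_natCast, ← Complex.ofReal_inv]
    exact Complex.zero_le_real.2 (by positivity)
  exact (posSemidef_sum _ fun k _ => posSemidef_sum _ fun i _ =>
    (ha k).submatrix fun u => (u, i)).smul hl

end TensorLegs

lemma le_rpow_mul_add_of_exchange {r X t A B : ℝ} (hr : 0 ≤ r) (hA : 0 ≤ A)
    (hB : 0 ≤ B) (hyoung : ∀ ε : ℝ, 0 < ε → t ≤ ε * X + ε ^ (-r) * A)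
    (hlt : r < 1 → X ≤ t + 4 * B)
    (hge : 1 ≤ r → ∀ ε : ℝ, 0 < ε → X ≤ t + 2 * r * (ε * (X + t) + 2 * ε ^ (1 - r) * B)) :
    X ≤ (8 * (r + 1)) ^ (r + 1) * (A + B) := by
  have hp : (1 : ℝ) ≤ r + 1 := by linarith
  have hmono : ∀ c : ℝ, 0 ≤ c → c ≤ 8 * (r + 1) → c ^ (r + 1) ≤ (8 * (r + 1)) ^ (r + 1) :=
    fun c hc h => Real.rpow_le_rpow hc h (by linarith)
  have hinv : ∀ c s : ℝ, 0 < c → (c⁻¹) ^ (-s) = c ^ s := fun c s hc => by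
    rw [Real.inv_rpow hc.le, Real.rpow_neg hc.le, inv_inv]
  rw [mul_add]
  rcases lt_or_ge r 1 with h | h
  · have h1 := hlt h
    have h2 := hyoung 2⁻¹ (by norm_num)
    rw [hinv 2 r (by norm_num)] at h2
    have h3 := mul_le_mul_of_nonneg_right (hmono 2 (by norm_num) (by linarith)) hA
    rw [Real.rpow_add_one (by norm_num) r] at h3
    have h4 : 8 * (r + 1) ≤ (8 * (r + 1)) ^ (r + 1) := Real.self_le_rpow_of_one_le (by linarith) hp
    have h5 := mul_le_mul_of_nonneg_right ((by linarith : 8 ≤ 8 * (r + 1)).trans h4) hB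
    linarith
  · have hp4 : 0 < 4 * (r + 1) := by linarith
    have h1 := hge h (4 * (r + 1))⁻¹ (inv_pos.2 hp4)
    have h2 := hyoung 6⁻¹ (by norm_num)
    rw [hinv 6 r (by norm_num)] at h2
    rw [← neg_sub r 1, hinv _ _ hp4] at h1
    have h3 := mul_le_mul_of_nonneg_right (hmono 6 (by norm_num) (by linarith)) hA
    rw [Real.rpow_add_one (by norm_num) r] at h3
    have h4 := mul_le_mul_of_nonneg_right (hmono (4 * (r + 1)) hp4.le (by linarith)) hB
    have h5 : (4 * (r + 1)) ^ (r + 1) = (4 * (r + 1)) ^ 2 * (4 * (r + 1)) ^ (r - 1) := by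
      rw [← Real.rpow_natCast, ← Real.rpow_add hp4]
      congr 1
      push_cast
      ring
    have hD : 0 ≤ (4 * (r + 1)) ^ (r - 1) * B := by positivity
    rw [h5] at h4
    have h6 : 2 * r * ((4 * (r + 1))⁻¹ * (X + t)) ≤ max 0 (1 / 2 * (X + t)) := by
      have hc : 2 * r * (4 * (r + 1))⁻¹ ≤ 1 / 2 := by
        rw [← div_eq_mul_inv, div_le_iff₀ hp4]
        linarith
      rw [← mul_assoc]
      rcases le_total 0 (X + t) with hXt | hXt
      · exact (mul_le_mul_of_nonneg_right hc hXt).trans (le_max_right _ _)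
      · exact (mul_nonpos_of_nonneg_of_nonpos (by positivity) hXt).trans (le_max_left _ _)
    have hA' : 0 ≤ (6 : ℝ) ^ r * A := by positivity
    have hD1 := mul_nonneg hD hr
    have hD2 := mul_nonneg hD (sq_nonneg r)
    rcases le_max_iff.1 h6 with h6 | h6 <;> nlinarith

lemma rpow_inv_le_mul_max {p X A B : ℝ} (hp : 1 ≤ p) (hX : 0 ≤ X) (hA : 0 ≤ A) (hB : 0 ≤ B)
    (h : X ≤ (8 * p) ^ p * (A + B)) :
    X ^ (1 / p) ≤ 16 * p * max (A ^ (1 / p)) (B ^ (1 / p)) := by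
  have hp0 : 0 < p := by linarith
  set M := max (A ^ (1 / p)) (B ^ (1 / p)) with hM
  have hM0 : 0 ≤ M := (Real.rpow_nonneg hA _).trans (le_max_left _ _)
  have hroot : ∀ C : ℝ, 0 ≤ C → C ^ (1 / p) ≤ M → C ≤ M ^ p := fun C hC hCM => by
    have := Real.rpow_le_rpow (Real.rpow_nonneg hC _) hCM hp0.le
    rwa [← Real.rpow_mul hC, one_div_mul_cancel hp0.ne', Real.rpow_one] at this
  have hAM := hroot A hA (le_max_left _ _)
  have hBM := hroot B hB (le_max_right _ _)
  have h2 : (2 : ℝ) ≤ 2 ^ p := Real.self_le_rpow_of_one_le (by norm_num) hp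
  have hXM : X ≤ (16 * p * M) ^ p := by
    calc X ≤ (8 * p) ^ p * (A + B) := h
      _ ≤ (8 * p) ^ p * (2 ^ p * M ^ p) := by
        have : 0 ≤ M ^ p := Real.rpow_nonneg hM0 p
        gcongr
        nlinarith
      _ = (16 * p * M) ^ p := by
        rw [← Real.mul_rpow (by norm_num) hM0, ← Real.mul_rpow (by positivity) (by positivity)]
        ring_nf
  have := Real.rpow_le_rpow hX hXM (by positivity : 0 ≤ 1 / p)
  rwa [← Real.rpow_mul (by positivity), mul_one_div_cancel hp0.ne', Real.rpow_one] at this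

section Rosenthal

variable {m l n : ℕ} {a : Fin n → Matrix (Fin m × Fin l) (Fin m × Fin l) ℂ}

lemma reTrace_ampl_mul_cfc_le_of_lt_one (ha : ∀ k, (a k).PosSemidef) {r : ℝ} (hr0 : 0 ≤ r)
    (hr : r < 1) (k : Fin n) :
    l * reTrace (ampl m l n k (a k) * cfc (fun x : ℝ => x ^ r) (∑ j, ampl m l n j (a j))) ≤
      reTrace ((∑ i : Fin l, Matrix.of fun u v : Fin m => a k (u, i) (v, i)) ⊗ₖ
        (1 : Matrix (Fin n → Fin l) (Fin n → Fin l) ℂ) *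
          cfc (fun x : ℝ => x ^ r) (∑ j, ampl m l n j (a j))) +
        4 * ((l : ℝ) ^ n * reTrace (cfc (fun x : ℝ => x ^ (r + 1)) (a k))) := by
  have hone := PosSemidef.one (n := Fin l) (R := ℂ)
  have hS := sum_ampl_posSemidef ha
  have hSa := (sum_ampl_sub_posSemidef ha k).kronecker hone
  have hsub : (∑ j, ampl m l n j (a j) - ampl m l n k (a k)) ⊗ₖ (1 : Matrix (Fin l) (Fin l) ℂ) =
      (∑ j, ampl m l n j (a j)) ⊗ₖ (1 : Matrix (Fin l) (Fin l) ℂ) -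
        ampl m l n k (a k) ⊗ₖ (1 : Matrix (Fin l) (Fin l) ℂ) := by
    rw [eq_sub_iff_add_eq, ← add_kronecker, sub_add_cancel]
  rw [hsub] at hSa
  have h := reTrace_mul_cfc_le_of_involutive_of_lt_one (swapLeg_involutive k)
    (hS.kronecker hone) ((ampl_posSemidef k (ha k)).kronecker hone) hSa
    (sum_ampl_kronecker_one_sub_swapLeg k) hr0 hr
  rwa [cfc_kronecker_one hS.1, reTrace_ampl_kronecker_one_mul, reTrace_swapLeg_mul_kronecker_one,
    reTrace_cfc_ampl_kronecker_one k (ha k)] at h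

lemma reTrace_ampl_mul_cfc_le_of_one_le (ha : ∀ k, (a k).PosSemidef) {r ε : ℝ} (hr : 1 ≤ r)
    (hε : 0 < ε) (k : Fin n) :
    l * reTrace (ampl m l n k (a k) * cfc (fun x : ℝ => x ^ r) (∑ j, ampl m l n j (a j))) ≤
      reTrace ((∑ i : Fin l, Matrix.of fun u v : Fin m => a k (u, i) (v, i)) ⊗ₖ
        (1 : Matrix (Fin n → Fin l) (Fin n → Fin l) ℂ) *
          cfc (fun x : ℝ => x ^ r) (∑ j, ampl m l n j (a j))) +
        2 * r * (ε * (l * reTrace (ampl m l n k (a k) *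
            cfc (fun x : ℝ => x ^ r) (∑ j, ampl m l n j (a j))) +
          reTrace ((∑ i : Fin l, Matrix.of fun u v : Fin m => a k (u, i) (v, i)) ⊗ₖ
            (1 : Matrix (Fin n → Fin l) (Fin n → Fin l) ℂ) *
              cfc (fun x : ℝ => x ^ r) (∑ j, ampl m l n j (a j)))) +
          2 * ε ^ (1 - r) * ((l : ℝ) ^ n * reTrace (cfc (fun x : ℝ => x ^ (r + 1)) (a k)))) := by
  have hone := PosSemidef.one (n := Fin l) (R := ℂ)
  have hS := sum_ampl_posSemidef ha
  have h := reTrace_mul_cfc_le_of_involutive_of_one_le (swapLeg_involutive k)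
    (hS.kronecker hone) ((ampl_posSemidef k (ha k)).kronecker hone)
    (sum_ampl_kronecker_one_sub_swapLeg k) hr hε
  rwa [cfc_kronecker_one hS.1, reTrace_ampl_kronecker_one_mul, reTrace_swapLeg_mul_kronecker_one,
    reTrace_cfc_ampl_kronecker_one k (ha k)] at h

/-- The `p`-th power form of the inequality, with `p = r + 1`. -/
lemma reTrace_cfc_sum_ampl_le (hm : 0 < m) (hl : 0 < l) (ha : ∀ k, (a k).PosSemidef) {r : ℝ}
    (hr : 0 ≤ r) :
    reTrace (cfc (fun x : ℝ => x ^ (r + 1)) (∑ k, ampl m l n k (a k))) / (m * (l : ℝ) ^ n) ≤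
      (8 * (r + 1)) ^ (r + 1) *
        (reTrace (cfc (fun x : ℝ => x ^ (r + 1)) ((l : ℂ)⁻¹ • ∑ k, ∑ i : Fin l,
          Matrix.of fun u v : Fin m => a k (u, i) (v, i))) / m +
        ∑ k, reTrace (cfc (fun x : ℝ => x ^ (r + 1)) (a k)) / (m * l)) := by
  have hS := sum_ampl_posSemidef ha
  have hE := inv_smul_sum_diag_posSemidef ha
  set S := ∑ k, ampl m l n k (a k) with hSdef
  set d : Fin n → Matrix (Fin m) (Fin m) ℂ := fun k =>
    ∑ i : Fin l, Matrix.of fun u v : Fin m => a k (u, i) (v, i) with hd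
  set E := (l : ℂ)⁻¹ • ∑ k, d k with hEdef
  set Y := cfc (fun x : ℝ => x ^ r) S with hY
  have hm' : (0 : ℝ) < m := Nat.cast_pos.2 hm
  have hl' : (0 : ℝ) < l := Nat.cast_pos.2 hl
  have hN : (0 : ℝ) < m * (l : ℝ) ^ n := by positivity
  have hsum : ∑ k, reTrace (ampl m l n k (a k) * Y) =
      reTrace (cfc (fun x : ℝ => x ^ (r + 1)) S) := by
    rw [← cfc_mul_rpow hS hr, ← reTrace_sum, ← Finset.sum_mul]
  have hsumd : ∑ k, reTrace (d k ⊗ₖ (1 : Matrix (Fin n → Fin l) (Fin n → Fin l) ℂ) * Y) =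
      l * reTrace (E ⊗ₖ (1 : Matrix (Fin n → Fin l) (Fin n → Fin l) ℂ) * Y) := by
    have h : (l : ℂ) • (E ⊗ₖ (1 : Matrix (Fin n → Fin l) (Fin n → Fin l) ℂ)) =
        ∑ k, d k ⊗ₖ (1 : Matrix (Fin n → Fin l) (Fin n → Fin l) ℂ) := by
      rw [← smul_kronecker, hEdef, smul_inv_smul₀ (by exact_mod_cast hl.ne')]
      ext P Q
      rw [kronecker_apply, Matrix.sum_apply, Matrix.sum_apply, Finset.sum_mul]
      rfl
    rw [← reTrace_sum, ← Finset.sum_mul, ← h, smul_mul_assoc, reTrace, trace_smul, reTrace,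
      smul_eq_mul, ← Complex.ofReal_natCast, Complex.re_ofReal_mul]
  have hdiag : ∀ c : ℝ, c * ∑ k, ((l : ℝ) ^ n * reTrace (cfc (fun x : ℝ => x ^ (r + 1)) (a k))) =
      c * (∑ k, reTrace (cfc (fun x : ℝ => x ^ (r + 1)) (a k)) / (m * l)) *
        (l * (m * (l : ℝ) ^ n)) := fun c => by
    rw [← Finset.mul_sum, ← Finset.sum_div]
    field_simp
  set B := ∑ k, reTrace (cfc (fun x : ℝ => x ^ (r + 1)) (a k)) / (m * l) with hB
  set s := reTrace (cfc (fun x : ℝ => x ^ (r + 1)) S) with hs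
  set t := reTrace (E ⊗ₖ (1 : Matrix (Fin n → Fin l) (Fin n → Fin l) ℂ) * Y) with ht
  refine le_rpow_mul_add_of_exchange (t := t / (m * (l : ℝ) ^ n)) hr ?_ ?_ ?_ ?_ ?_
  · exact div_nonneg (reTrace_cfc_nonneg hE _) hm'.le
  · exact Finset.sum_nonneg fun k _ => div_nonneg (reTrace_cfc_nonneg (ha k) _) (by positivity)
  · intro ε hε
    have h := reTrace_mul_cfc_rpow_le (hE.kronecker
      (PosSemidef.one (n := Fin n → Fin l) (R := ℂ))) hS hr hε
    rw [cfc_kronecker_one hE.1, reTrace_kronecker_one] at h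
    simp only [Fintype.card_fun, Fintype.card_fin, Nat.cast_pow] at h
    rw [div_le_iff₀ hN]
    refine h.trans (le_of_eq ?_)
    rw [hs]
    field_simp
  · intro hr1
    have h := Finset.sum_le_sum fun k (_ : k ∈ Finset.univ) =>
      reTrace_ampl_mul_cfc_le_of_lt_one ha hr hr1 k
    rw [Finset.sum_add_distrib, ← Finset.mul_sum, ← Finset.mul_sum, hdiag, hsum, hsumd] at h
    rw [div_le_iff₀ hN, add_mul, div_mul_cancel₀ _ hN.ne']
    refine le_of_mul_le_mul_left ?_ hl'
    linarith
  · intro hr1 ε hε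
    have h := Finset.sum_le_sum fun k (_ : k ∈ Finset.univ) =>
      reTrace_ampl_mul_cfc_le_of_one_le ha hr1 hε k
    rw [Finset.sum_add_distrib, ← Finset.mul_sum, ← Finset.mul_sum, Finset.sum_add_distrib,
      ← Finset.mul_sum, ← Finset.mul_sum, Finset.sum_add_distrib, ← Finset.mul_sum, hdiag, hsum,
      hsumd] at h
    rw [div_le_iff₀ hN]
    refine le_of_mul_le_mul_left (h.trans (le_of_eq ?_)) hl'
    field_simp

end Rosenthal

/-- Noncommutative Rosenthal-type inequality: for positive `a^1,…,a^n ∈ M_{ml}` and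
`1 ≤ p < ∞`, the tensor-independent sum `∑ (id ⊗ π_k)(a^k)` satisfies
`‖∑_k (id⊗π_k)(a^k)‖_p ≤ c p max( ‖(1/l) ∑_{k,i} a^k_{ii}‖_p , (∑_k ‖a^k‖_p^p)^{1/p})`
with an absolute constant `c` independent of all dimensions. -/
theorem stmt_5 :
    ∃ c : ℝ, 0 < c ∧
      ∀ (m l n : ℕ) (p : ℝ), 1 ≤ p →
        ∀ a : Fin n → Matrix (Fin m × Fin l) (Fin m × Fin l) ℂ,
          (∀ k, (a k).PosSemidef) →
          ntrNorm p (∑ k, ampl m l n k (a k)) ≤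
            c * p * max
              (ntrNorm p ((l : ℂ)⁻¹ •
                ∑ k, ∑ i : Fin l, Matrix.of fun u v : Fin m => a k (u, i) (v, i)))
              ((∑ k, ntrNorm p (a k) ^ p) ^ (1/p)) := by
  refine ⟨16, by norm_num, fun m l n p hp a ha => ?_⟩
  have hp0 : 0 < p := by linarith
  have hE := inv_smul_sum_diag_posSemidef ha
  have hS := sum_ampl_posSemidef ha
  have hpow : ∀ k, ntrNorm p (a k) ^ p =
      reTrace (cfc (fun x : ℝ => x ^ p) (a k)) / (m * l) := fun k => by
    rw [ntrNorm_eq (ha k),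
      ← Real.rpow_mul (div_nonneg (reTrace_cfc_nonneg (ha k) p) (by positivity)),
      one_div_mul_cancel hp0.ne', Real.rpow_one]
    simp
  have hB : 0 ≤ ∑ k, reTrace (cfc (fun x : ℝ => x ^ p) (a k)) / (m * l) :=
    Finset.sum_nonneg fun k _ => div_nonneg (reTrace_cfc_nonneg (ha k) _) (by positivity)
  simp only [hpow]
  by_cases h : 0 < m ∧ 0 < l
  · have key := reTrace_cfc_sum_ampl_le h.1 h.2 ha (r := p - 1) (by linarith)
    rw [sub_add_cancel] at key
    rw [ntrNorm_eq hS, ntrNorm_eq hE]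
    simp only [Fintype.card_prod, Fintype.card_fun, Fintype.card_fin, Nat.cast_mul, Nat.cast_pow]
    exact rpow_inv_le_mul_max hp (div_nonneg (reTrace_cfc_nonneg hS p) (by positivity))
      (div_nonneg (reTrace_cfc_nonneg hE p) (by positivity)) hB key
  · have hzero : ∑ k, ampl m l n k (a k) = 0 := by
      refine Finset.sum_eq_zero fun k _ => ?_
      ext P Q
      exact absurd ⟨Fin.pos P.1, Fin.pos (P.2 k)⟩ h
    rw [hzero, ntrNorm_zero hp]
    exact mul_nonneg (by positivity) (le_max_of_le_right (Real.rpow_nonneg hB _))
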